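/- The subgroup of GL_{2n}(R) generated by the matrices of the elementary transformations T_i(r') for i ∈ {1, …, n} and r' ∈ R ∩ ℝ, together with the matrices of T_{i,j}(r) for distinct i, j ∈ {1, …, n} and r ∈ R (all with positive indices), is exactly the group of block matrices {[[I_n, B], [0, I_n]] : B = B*} of unipotent upper block triangular matrices with self-adjoint upper right block. -/

import Mathlib

open Matrix

/-- The standard basis vector e_p of R^{2n}: for p = Sum.inl i it is e_i
(i ∈ {1, …, n}), and for p = Sum.inr i it is e_{−i}. -/
noncomputable def ee (n : ℕ) (p : Fin n ⊕ Fin n) : Fin n ⊕ Fin n → ℂ :=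
  Pi.single p 1

/-- The sesquilinear intersection form on R^{2n} (linear in the first variable,
conjugate-linear in the second, with ⟨e_i, e_{−i}⟩ = 1 and all other pairs of
basis vectors pairing to 0). -/
noncomputable def PrymForm (n : ℕ) (x y : Fin n ⊕ Fin n → ℂ) : ℂ :=
  ∑ i : Fin n,
    (x (Sum.inl i) * starRingEnd ℂ (y (Sum.inr i))
      - x (Sum.inr i) * starRingEnd ℂ (y (Sum.inl i)))

/-- The elementary transformation T_p(r') : x ↦ x + r'⟨x, e_p⟩e_p. -/
noncomputable def Tsingle (n : ℕ) (p : Fin n ⊕ Fin n) (r : ℂ)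
    (x : Fin n ⊕ Fin n → ℂ) : Fin n ⊕ Fin n → ℂ :=
  x + (r * PrymForm n x (ee n p)) • ee n p

/-- The elementary transformation
T_{p,q}(r) : x ↦ x + r⟨x, e_p⟩e_q + conj(r)⟨x, e_q⟩e_p. -/
noncomputable def Tdouble (n : ℕ) (p q : Fin n ⊕ Fin n) (r : ℂ)
    (x : Fin n ⊕ Fin n → ℂ) : Fin n ⊕ Fin n → ℂ :=
  x + (r * PrymForm n x (ee n p)) • ee n q
    + (starRingEnd ℂ r * PrymForm n x (ee n q)) • ee n p

theorem prym_ee (n : ℕ) (x : Fin n ⊕ Fin n → ℂ) (i : Fin n) :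
    PrymForm n x (ee n (Sum.inl i)) = - x (Sum.inr i) := by
  simp [PrymForm, ee, Pi.single_apply, apply_ite (starRingEnd ℂ)]

theorem single_mulVec_aux (n : ℕ) (i j : Fin n) (r : ℂ) (v : Fin n → ℂ) (k : Fin n) :
    (Matrix.single i j r).mulVec v k = if k = i then r * v j else 0 := by
  rw [Matrix.single_mulVec]
  by_cases h : k = i
  · subst h; simp
  · simp [h]

theorem Tsingle_eq (n : ℕ) (i : Fin n) (r : ℂ) (x : Fin n ⊕ Fin n → ℂ) :
    (Matrix.fromBlocks 1 (Matrix.single i i (-r)) 0 1).mulVec x = Tsingle n (Sum.inl i) r x := by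
  rw [Matrix.fromBlocks_mulVec]
  ext (k | k)
  · simp only [Sum.elim_inl, Pi.add_apply, single_mulVec_aux, Tsingle, prym_ee, Pi.smul_apply,
      Pi.single_apply, Matrix.one_mulVec, Function.comp, smul_eq_mul, Sum.inl.injEq]
    simp only [ee, Pi.single_apply, Sum.inl.injEq]
    split_ifs <;> ring
  · simp [Tsingle, ee, Function.comp]

theorem Tdouble_eq (n : ℕ) (i j : Fin n) (r : ℂ) (x : Fin n ⊕ Fin n → ℂ) :
    (Matrix.fromBlocks 1 (Matrix.single j i (-r) + Matrix.single i j (-(starRingEnd ℂ r))) 0 1).mulVec x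
      = Tdouble n (Sum.inl i) (Sum.inl j) r x := by
  rw [Matrix.fromBlocks_mulVec]
  ext (k | k)
  · simp only [Sum.elim_inl, Pi.add_apply, single_mulVec_aux, Tdouble, prym_ee, Pi.smul_apply,
      Pi.single_apply, Matrix.one_mulVec, Function.comp, smul_eq_mul, Sum.inl.injEq,
      Matrix.add_mulVec]
    simp only [ee, Pi.single_apply, Sum.inl.injEq]
    split_ifs <;> ring
  · simp [Tdouble, ee, Function.comp]

/-- The unipotent block matrix as an element of GL. -/
noncomputable def UU (n : ℕ) (B : Matrix (Fin n) (Fin n) ℂ) : GL (Fin n ⊕ Fin n) ℂ where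
  val := Matrix.fromBlocks 1 B 0 1
  inv := Matrix.fromBlocks 1 (-B) 0 1
  val_inv := by simp [Matrix.fromBlocks_multiply]
  inv_val := by simp [Matrix.fromBlocks_multiply]

theorem UU_add (n : ℕ) (A B : Matrix (Fin n) (Fin n) ℂ) : UU n (A + B) = UU n A * UU n B := by
  apply Units.ext
  simp [UU, Matrix.fromBlocks_multiply, add_comm]

theorem UU_zero (n : ℕ) : UU n 0 = 1 := by
  apply Units.ext
  simp [UU]

theorem UU_neg (n : ℕ) (A : Matrix (Fin n) (Fin n) ℂ) : UU n (-A) = (UU n A)⁻¹ := by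
  apply Units.ext
  rfl

theorem conj_mem_aux (d : ℕ) (hd : 1 ≤ d) (ζ : ℂ) (hζ : IsPrimitiveRoot ζ d) (r : ℂ)
    (hr : r ∈ Subring.closure {ζ}) : starRingEnd ℂ r ∈ Subring.closure {ζ} := by
  have h : Subring.closure {ζ} ≤ (Subring.closure {ζ}).comap (starRingEnd ℂ) := by
    rw [Subring.closure_le, Set.singleton_subset_iff]
    change starRingEnd ℂ ζ ∈ Subring.closure {ζ}
    have h1 : ‖ζ‖ = 1 := Complex.norm_eq_one_of_pow_eq_one hζ.pow_eq_one (by omega)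
    have h2 : starRingEnd ℂ ζ = ζ ^ (d - 1) := by
      have h0 : ζ ≠ 0 := by
        intro h; simp [h] at h1
      apply mul_left_cancel₀ h0
      rw [Complex.mul_conj, Complex.normSq_eq_norm_sq, h1, ← pow_succ', Nat.sub_add_cancel hd,
        hζ.pow_eq_one]
      simp
    rw [h2]
    exact pow_mem (Subring.subset_closure (Set.mem_singleton ζ)) _
  exact h hr

theorem decomp_aux (n : ℕ) (B : Matrix (Fin n) (Fin n) ℂ) :
    B = ∑ i, ∑ j, ((if i = j then Matrix.single i i (B i i) else 0) +
      (if i < j then Matrix.single i j (B i j) + Matrix.single j i (B j i) else 0)) := by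
  have h1 : ∑ i, ∑ j, (if i < j then Matrix.single j i (B j i) else 0)
      = ∑ i, ∑ j, (if j < i then Matrix.single i j (B i j) else 0) := Finset.sum_comm
  have h2 : ∀ i j, (if i < j then Matrix.single i j (B i j) + Matrix.single j i (B j i) else 0)
      = (if i < j then Matrix.single i j (B i j) else 0)
        + (if i < j then Matrix.single j i (B j i) else 0) := by
    intro i j; split_ifs <;> simp
  simp only [h2, Finset.sum_add_distrib]
  rw [h1]
  simp only [← Finset.sum_add_distrib]
  conv_lhs => rw [Matrix.matrix_eq_sum_single B]
  refine Finset.sum_congr rfl fun i _ => Finset.sum_congr rfl fun j _ => ?_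
  rcases lt_trichotomy i j with h | h | h
  · simp [h, h.ne, h.not_gt]
  · subst h; simp
  · simp [h, h.ne', h.not_gt]

/-- The subgroup of GL_{2n}(R) generated by the matrices of T_i(r')
(i ∈ {1, …, n}, r' ∈ R ∩ ℝ) and of T_{i,j}(r) (distinct i, j ∈ {1, …, n}, r ∈ R)
is exactly {[[I, B], [0, I]] : B = B*}, the unipotent upper block triangular
matrices with self-adjoint upper right block over R. Linear maps are identified
with matrices via the ordered basis e_1, …, e_n, e_{−1}, …, e_{−n} (so the matrix
of a map T is the M with M.mulVec x = T x for all x). -/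
theorem stmt_6 (d n : ℕ) (hd : 1 ≤ d) (hn : 1 ≤ n) (ζ : ℂ)
    (hζ : IsPrimitiveRoot ζ d)
    (R : Subring ℂ) (hR : R = Subring.closure {ζ})
    (S : Set (GL (Fin n ⊕ Fin n) ℂ))
    (hS : S = {g : GL (Fin n ⊕ Fin n) ℂ | (∃ (i : Fin n) (r' : ℂ), r' ∈ R ∧ (∃ s : ℝ, r' = (s : ℂ)) ∧
        ∀ x : Fin n ⊕ Fin n → ℂ,
          (g : Matrix (Fin n ⊕ Fin n) (Fin n ⊕ Fin n) ℂ).mulVec x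
            = Tsingle n (Sum.inl i) r' x) ∨
      (∃ (i j : Fin n) (r : ℂ), i ≠ j ∧ r ∈ R ∧
        ∀ x : Fin n ⊕ Fin n → ℂ,
          (g : Matrix (Fin n ⊕ Fin n) (Fin n ⊕ Fin n) ℂ).mulVec x
            = Tdouble n (Sum.inl i) (Sum.inl j) r x)}) :
    (Subgroup.closure S : Set (GL (Fin n ⊕ Fin n) ℂ)) =
      {g : GL (Fin n ⊕ Fin n) ℂ | ∃ B : Matrix (Fin n) (Fin n) ℂ, Bᴴ = B ∧ (∀ i j, B i j ∈ R) ∧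
        (g : Matrix (Fin n ⊕ Fin n) (Fin n ⊕ Fin n) ℂ) = Matrix.fromBlocks 1 B 0 1} := by
  have hconj : ∀ r ∈ R, starRingEnd ℂ r ∈ R := by
    subst hR; exact fun r hr => conj_mem_aux d hd ζ hζ r hr
  have hsing : ∀ (i j : Fin n) (r : ℂ), r ∈ R → ∀ k l, Matrix.single i j r k l ∈ R := by
    intro i j r hr k l
    rw [Matrix.single_apply]
    split_ifs
    · exact hr
    · exact R.zero_mem
  ext g
  simp only [SetLike.mem_coe, Set.mem_ofPred_eq]
  constructor
  · intro hg
    suffices h : ∃ B : Matrix (Fin n) (Fin n) ℂ, Bᴴ = B ∧ (∀ i j, B i j ∈ R) ∧ g = UU n B by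
      obtain ⟨B, h1, h2, h3⟩ := h
      exact ⟨B, h1, h2, by rw [h3]; rfl⟩
    induction hg using Subgroup.closure_induction with
    | mem g hg =>
      rw [hS] at hg
      rcases hg with ⟨i, r, hr, ⟨s, hs⟩, hx⟩ | ⟨i, j, r, hij, hr, hx⟩
      · refine ⟨Matrix.single i i (-r), ?_, hsing _ _ _ (neg_mem hr), ?_⟩
        · rw [Matrix.conjTranspose_single, hs]; simp
        · apply Units.ext
          apply Matrix.mulVec_injective
          funext x
          rw [hx, ← Tsingle_eq]; rfl
      · refine ⟨Matrix.single j i (-r) + Matrix.single i j (-(starRingEnd ℂ r)), ?_, ?_, ?_⟩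
        · rw [Matrix.conjTranspose_add, Matrix.conjTranspose_single, Matrix.conjTranspose_single,
            add_comm]
          simp
        · intro k l
          exact add_mem (hsing _ _ _ (neg_mem hr) k l) (hsing _ _ _ (neg_mem (hconj r hr)) k l)
        · apply Units.ext
          apply Matrix.mulVec_injective
          funext x
          rw [hx, ← Tdouble_eq]; rfl
    | one => exact ⟨0, by simp, fun _ _ => R.zero_mem, (UU_zero n).symm⟩
    | mul a b _ _ ha hb =>
      obtain ⟨A, a1, a2, a3⟩ := ha
      obtain ⟨B, b1, b2, b3⟩ := hb
      exact ⟨A + B, by rw [Matrix.conjTranspose_add, a1, b1],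
        fun i j => add_mem (a2 i j) (b2 i j), by rw [UU_add, a3, b3]⟩
    | inv a _ ha =>
      obtain ⟨A, a1, a2, a3⟩ := ha
      exact ⟨-A, by rw [Matrix.conjTranspose_neg, a1], fun i j => neg_mem (a2 i j),
        by rw [UU_neg, a3]⟩
  · rintro ⟨B, hB, hBR, hg⟩
    have hgU : g = UU n B := Units.ext hg
    let H : AddSubgroup (Matrix (Fin n) (Fin n) ℂ) :=
      { carrier := {A | UU n A ∈ Subgroup.closure S}
        zero_mem' := by
          change UU n 0 ∈ Subgroup.closure S
          rw [UU_zero]; exact one_mem _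
        add_mem' := by
          intro a b ha hb
          change UU n (a + b) ∈ Subgroup.closure S
          rw [UU_add]; exact mul_mem ha hb
        neg_mem' := by
          intro a ha
          change UU n (-a) ∈ Subgroup.closure S
          rw [UU_neg]; exact inv_mem ha }
    have hBc : ∀ i j, starRingEnd ℂ (B i j) = B j i := by
      intro i j
      conv_rhs => rw [← hB]
      rfl
    suffices h : B ∈ H by rw [hgU]; exact h
    rw [decomp_aux n B]
    refine sum_mem fun i _ => sum_mem fun j _ => add_mem ?_ ?_
    · split_ifs
      · apply Subgroup.subset_closure
        rw [hS]
        refine Or.inl ⟨i, -(B i i), neg_mem (hBR i i), ⟨-(B i i).re, ?_⟩, fun x => ?_⟩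
        · have := Complex.conj_eq_iff_re.mp (hBc i i)
          rw [Complex.ofReal_neg, this]
        · rw [← Tsingle_eq, neg_neg]; rfl
      · exact zero_mem _
    · split_ifs with hij
      · apply Subgroup.subset_closure
        rw [hS]
        refine Or.inr ⟨j, i, -(B i j), hij.ne', neg_mem (hBR i j), fun x => ?_⟩
        rw [← Tdouble_eq, map_neg, neg_neg, neg_neg, hBc]; rfl
      · exact zero_mem _
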